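/- arXiv:1811.05174 — 2 statements merged into one kernel-verified Lean document; each statement's English description precedes it below -/
import Mathlib

section
/- Let N ≥ 2, let 0 < θ < 1/N, and let Φ: D^N → D^N be defined by Φ(z₁, …, z_N) = (λ_θ(z₁), λ_θ(z₁), …, λ_θ(z₁)). Then the composition operator C_Φ: H²(D^N) → H²(D^N) is compact, and there are constants C > 0 and d > 0, depending only on θ and N, such that a_n(C_Φ) ≤ C e^{−d √n} for all n ≥ 1. -/
open Complex MeasureTheory Set Filter
open scoped ENNReal Topology

noncomputable section

/-- The open unit disk in `ℂ`. -/
def unitDisk : Set ℂ := Metric.ball (0 : ℂ) 1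

/-- A symbol: a non-constant analytic self-map of the unit disk. -/
structure IsSymbol (φ : ℂ → ℂ) : Prop where
  mapsTo : Set.MapsTo φ unitDisk unitDisk
  diff : DifferentiableOn ℂ φ unitDisk
  nonconst : ¬ ∃ c : ℂ, Set.EqOn φ (fun _ => c) unitDisk

/-- `φ` is `p`-valent: every `w ∈ 𝔻` has at most `p` preimages in `𝔻`. -/
def Valent (φ : ℂ → ℂ) (p : ℕ) : Prop :=
  ∀ w ∈ unitDisk, (unitDisk ∩ φ ⁻¹' {w}).encard ≤ p

/-- The radial limit of `φ` at the boundary point `toCircle θ` exists and equals `w`.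
The circle `𝕋` is parametrized by `AddCircle 1` (so that `volume` is the normalized
Haar measure `m`). -/
def HasRadialLimit (φ : ℂ → ℂ) (θ : AddCircle (1 : ℝ)) (w : ℂ) : Prop :=
  Filter.Tendsto (fun r : ℝ => φ (r * (AddCircle.toCircle θ : ℂ)))
    (nhdsWithin 1 (Set.Iio 1)) (nhds w)

/-- The pull-back measure `m_φ(S) = m({ξ : φ*(ξ) ∈ S})`. -/
def pullbackMeasure (φ : ℂ → ℂ) (S : Set ℂ) : ℝ≥0∞ :=
  volume {θ : AddCircle (1 : ℝ) | ∃ w ∈ S, HasRadialLimit φ θ w}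

/-- `ρ_φ(h) = sup_{ξ ∈ 𝕋} m_φ[S(ξ,h)]`, where `S(ξ,h) = {z : |z - ξ| ≤ h}`. -/
def rho (φ : ℂ → ℂ) (h : ℝ) : ℝ≥0∞ :=
  ⨆ ξ : Circle, pullbackMeasure φ {z : ℂ | ‖z - (ξ : ℂ)‖ ≤ h}

/-- The `n`-th approximation number of a bounded operator between normed spaces:
the distance of `T` to operators of rank `< n`. -/
def approxNum {E F : Type*} [NormedAddCommGroup E] [NormedAddCommGroup F]
    [NormedSpace ℂ E] [NormedSpace ℂ F] (n : ℕ) (T : E →L[ℂ] F) : ℝ :=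
  sInf {c : ℝ | ∃ R : E →L[ℂ] F,
    Module.rank ℂ (LinearMap.range (R : E →ₗ[ℂ] F)) < (n : Cardinal) ∧ c = ‖T - R‖}

/-- The Hardy space `H²(𝔻)` in its coefficient model `ℓ²(ℕ)`. -/
abbrev H2 := lp (fun _ : ℕ => ℂ) 2

/-- The analytic function on `𝔻` associated with an element of `H²`. -/
def H2.eval (a : H2) (z : ℂ) : ℂ := ∑' n : ℕ, a n * z ^ n

/-- `T` is the composition operator with symbol `φ` on `H²(𝔻)`. -/
def IsCompOp (φ : ℂ → ℂ) (T : H2 →L[ℂ] H2) : Prop :=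
  ∀ a : H2, ∀ z ∈ unitDisk, H2.eval (T a) z = H2.eval a (φ z)

/-- The open unit polydisk `𝔻^N`. -/
def polyDisk (N : ℕ) : Set (Fin N → ℂ) := {z | ∀ i, ‖z i‖ < 1}

/-- The Hardy space `H²(𝔻^N)` in its coefficient model `ℓ²(ℕ^N)`. -/
abbrev H2poly (N : ℕ) := lp (fun _ : Fin N → ℕ => ℂ) 2

/-- The analytic function on `𝔻^N` associated with an element of `H²(𝔻^N)`. -/
def H2poly.eval {N : ℕ} (a : H2poly N) (z : Fin N → ℂ) : ℂ :=
  ∑' α : Fin N → ℕ, a α * ∏ i, z i ^ α i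

/-- `T` is the composition operator with symbol `Φ` on `H²(𝔻^N)`. -/
def IsCompOpPoly {N : ℕ} (Φ : (Fin N → ℂ) → (Fin N → ℂ))
    (T : H2poly N →L[ℂ] H2poly N) : Prop :=
  ∀ a : H2poly N, ∀ z ∈ polyDisk N, H2poly.eval (T a) z = H2poly.eval a (Φ z)

/-- The lens map `λ_θ`. -/
def lens (θ : ℝ) (z : ℂ) : ℂ :=
  ((1 + z) ^ (θ : ℂ) - (1 - z) ^ (θ : ℂ)) / ((1 + z) ^ (θ : ℂ) + (1 - z) ^ (θ : ℂ))

lemma HasSum.of_forall_eq {ι E : Type*} [AddCommMonoid E] [TopologicalSpace E] {f g : ι → E}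
    {a : E} (h : HasSum g a) (e : ∀ i, f i = g i) : HasSum f a :=
  (funext e : f = g) ▸ h

/-! ### Sums over multi-indices and the diagonal kernel -/

lemma hasSum_prod_pow (N : ℕ) {r : ℝ} (h0 : 0 ≤ r) (h1 : r < 1) :
    HasSum (fun α : Fin N → ℕ => ∏ i, r ^ α i) ((1 - r)⁻¹ ^ N) := by
  induction N with
  | zero => simp
  | succ N ih =>
    have hg := hasSum_geometric_of_lt_one h0 h1
    have hs := hg.summable.mul_of_nonneg ih.summable (fun _ => by positivity)
      (fun _ => Finset.prod_nonneg fun _ _ => by positivity)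
    have h := hg.mul ih hs
    rw [← (Fin.consEquiv (fun _ : Fin (N + 1) => ℕ)).hasSum_iff]
    have e : (1 - r)⁻¹ ^ (N + 1) = (1 - r)⁻¹ * (1 - r)⁻¹ ^ N := by ring
    rw [e]
    refine h.of_forall_eq fun x => ?_
    simp [Fin.prod_univ_succ, Fin.consEquiv]

lemma hasSum_norm_sq_prod_pow (N : ℕ) {w : ℂ} (hw : ‖w‖ < 1) :
    HasSum (fun α : Fin N → ℕ => ‖∏ i, (starRingEnd ℂ w) ^ α i‖ ^ 2)
      ((1 - ‖w‖ ^ 2)⁻¹ ^ N) := by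
  have h := hasSum_prod_pow N (sq_nonneg ‖w‖) (by nlinarith [norm_nonneg w])
  convert h using 2 with α
  simp only [norm_prod, norm_pow, RCLike.norm_conj, ← Finset.prod_pow]
  exact Finset.prod_congr rfl fun i _ => by ring

lemma memℓp_prod_pow (N : ℕ) {w : ℂ} (hw : ‖w‖ < 1) :
    Memℓp (fun α : Fin N → ℕ => ∏ i, (starRingEnd ℂ w) ^ α i) 2 := by
  rw [memℓp_gen_iff (by norm_num)]
  simpa using (hasSum_norm_sq_prod_pow N hw).summable

/-- The vector representing evaluation at the diagonal point `(w, …, w)`. -/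
def diagKernel (N : ℕ) (w : ℂ) (hw : ‖w‖ < 1) : H2poly N :=
  ⟨fun α => ∏ i, (starRingEnd ℂ w) ^ α i, memℓp_prod_pow N hw⟩

lemma diagKernel_apply {N : ℕ} {w : ℂ} (hw : ‖w‖ < 1) (α : Fin N → ℕ) :
    diagKernel N w hw α = ∏ i, (starRingEnd ℂ w) ^ α i := rfl

lemma norm_diagKernel_sq (N : ℕ) {w : ℂ} (hw : ‖w‖ < 1) :
    ‖diagKernel N w hw‖ ^ 2 = (1 - ‖w‖ ^ 2)⁻¹ ^ N := by
  have h := lp.norm_rpow_eq_tsum (p := 2) (by norm_num) (diagKernel N w hw)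
  simp only [ENNReal.toReal_ofNat, Real.rpow_ofNat] at h
  rw [h]
  exact (hasSum_norm_sq_prod_pow N hw).tsum_eq

lemma hasSum_inner_diagKernel {N : ℕ} {w : ℂ} (hw : ‖w‖ < 1) (a : H2poly N) :
    HasSum (fun α => a α * ∏ i, w ^ α i) (inner ℂ (diagKernel N w hw) a) := by
  have h := lp.hasSum_inner (𝕜 := ℂ) (diagKernel N w hw) a
  refine h.of_forall_eq fun α => ?_
  simp [diagKernel_apply, map_prod, map_pow]

/-- The restriction of an element of `H²(𝔻^N)` to the diagonal. -/
def diagEval {N : ℕ} (a : H2poly N) (w : ℂ) : ℂ := H2poly.eval a (fun _ => w)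

lemma diagEval_eq_inner {N : ℕ} {w : ℂ} (hw : ‖w‖ < 1) (a : H2poly N) :
    diagEval a w = inner ℂ (diagKernel N w hw) a :=
  (hasSum_inner_diagKernel hw a).tsum_eq

lemma norm_diagEval_le {N : ℕ} {w : ℂ} (hw : ‖w‖ < 1) (a : H2poly N) :
    ‖diagEval a w‖ ≤ (1 - ‖w‖ ^ 2) ^ (-(N : ℝ) / 2) * ‖a‖ := by
  rw [diagEval_eq_inner hw]
  refine (norm_inner_le_norm _ _).trans (mul_le_mul_of_nonneg_right ?_ (norm_nonneg _))
  have hp : 0 < 1 - ‖w‖ ^ 2 := by nlinarith [norm_nonneg w]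
  refine (pow_le_pow_iff_left₀ (norm_nonneg _) (by positivity) two_ne_zero).1 (le_of_eq ?_)
  rw [norm_diagKernel_sq, ← Real.rpow_natCast (_ ^ _) 2, ← Real.rpow_mul hp.le, inv_pow]
  push_cast
  rw [div_mul_cancel₀ _ (by norm_num), Real.rpow_neg hp.le, Real.rpow_natCast]

lemma diagEval_add {N : ℕ} {w : ℂ} (hw : ‖w‖ < 1) (a b : H2poly N) :
    diagEval (a + b) w = diagEval a w + diagEval b w := by
  simp only [diagEval_eq_inner hw, inner_add_right]

lemma diagEval_smul {N : ℕ} {w : ℂ} (hw : ‖w‖ < 1) (c : ℂ) (a : H2poly N) :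
    diagEval (c • a) w = c * diagEval a w := by
  simp only [diagEval_eq_inner hw, inner_smul_right]

lemma differentiableOn_diagEval {N : ℕ} (a : H2poly N) :
    DifferentiableOn ℂ (diagEval a) (Metric.ball 0 1) := by
  intro w hw
  rw [mem_ball_zero_iff] at hw
  obtain ⟨ρ, hwρ, hρ⟩ := exists_between hw
  have hρ0 : 0 ≤ ρ := (norm_nonneg w).trans hwρ.le
  have hρ1 : ‖(ρ : ℂ)‖ < 1 := by simpa [abs_of_nonneg hρ0] using hρ
  have hs := (hasSum_inner_diagKernel hρ1 a).summable.norm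
  have h := differentiableOn_tsum_of_summable_norm (U := Metric.ball (0 : ℂ) ρ)
    (F := fun (α : Fin N → ℕ) w => a α * ∏ i, w ^ α i) hs
    (fun α => by fun_prop) Metric.isOpen_ball (by
      intro α v hv
      rw [mem_ball_zero_iff] at hv
      simp only [norm_mul, norm_prod, norm_pow, Complex.norm_real, Real.norm_of_nonneg hρ0]
      gcongr)
  exact (h.differentiableAt (Metric.isOpen_ball.mem_nhds (by simpa using hwρ))).differentiableWithinAt

/-! ### Functions on the disk with controlled growth belong to the Hardy space -/

/-- The Taylor coefficients at the origin. -/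
def taylorCoeff (h : ℂ → ℂ) (k : ℕ) : ℂ := (k.factorial : ℂ)⁻¹ * iteratedDeriv k h 0

lemma hasSum_taylorCoeff {h : ℂ → ℂ} (hd : DifferentiableOn ℂ h (Metric.ball 0 1)) {z : ℂ}
    (hz : ‖z‖ < 1) : HasSum (fun k => taylorCoeff h k * z ^ k) (h z) := by
  refine (Complex.hasSum_taylorSeries_on_ball hd (mem_ball_zero_iff.2 hz)).of_forall_eq
    fun k => ?_
  simp only [taylorCoeff, sub_zero, smul_eq_mul]
  ring

lemma sum_taylorCoeff_sq_le_integral {h : ℂ → ℂ}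
    (hd : DifferentiableOn ℂ h (Metric.ball 0 1)) {r : ℝ} (hr0 : 0 ≤ r) (hr1 : r < 1)
    (s : Finset ℕ) :
    ∑ k ∈ s, (‖taylorCoeff h k‖ * r ^ k) ^ 2 ≤
      ∫ x in (0 : ℝ)..1, ‖h (r * exp (2 * Real.pi * x * I))‖ ^ 2 := by
  have hr : ‖(r : ℂ)‖ < 1 := by simpa [abs_of_nonneg hr0] using hr1
  have hsum := (hasSum_taylorCoeff hd hr).summable
  have hS : Summable fun k : ℕ =>
      (taylorCoeff h k * (r : ℂ) ^ k) • (fourier (k : ℤ) : C(AddCircle (1 : ℝ), ℂ)) := by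
    refine Summable.of_norm (hsum.norm.congr fun k => ?_)
    rw [norm_smul, fourier_norm, mul_one]
  obtain ⟨F, hF⟩ := hS
  have hFx : ∀ x : AddCircle (1 : ℝ), F x = h (r * AddCircle.toCircle x) := by
    intro x
    have h1 := (ContinuousMap.evalCLM ℂ x).hasSum hF
    have hx : ‖(r : ℂ) * AddCircle.toCircle x‖ < 1 := by
      rwa [norm_mul, Circle.norm_coe, mul_one]
    refine h1.unique ((hasSum_taylorCoeff hd hx).of_forall_eq fun k => ?_)
    simp [fourier_apply, mul_pow, AddCircle.toCircle_nsmul, mul_assoc]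
  set L : C(AddCircle (1 : ℝ), ℂ) →L[ℂ] Lp ℂ 2 (AddCircle.haarAddCircle (T := (1 : ℝ))) :=
    ContinuousMap.toLp 2 AddCircle.haarAddCircle ℂ with hL
  have h2 := L.hasSum hF
  have hin : ∀ k : ℕ, inner ℂ (fourierLp 2 (k : ℤ)) (L F) = taylorCoeff h k * (r : ℂ) ^ k := by
    intro k
    have h3 := (innerSL ℂ (fourierLp (T := (1 : ℝ)) 2 (k : ℤ))).hasSum h2
    refine h3.unique ?_
    have horth := orthonormal_iff_ite.1 (orthonormal_fourier (T := (1 : ℝ)))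
    have h4 : ∀ j : ℕ, innerSL ℂ (fourierLp (T := (1 : ℝ)) 2 (k : ℤ))
        (L ((taylorCoeff h j * (r : ℂ) ^ j) • fourier (j : ℤ))) =
          if j = k then taylorCoeff h k * (r : ℂ) ^ k else 0 := by
      intro j
      rw [map_smul, map_smul, innerSL_apply_apply,
        show L (fourier (j : ℤ)) = fourierLp 2 (j : ℤ) from rfl, horth]
      by_cases hjk : j = k
      · simp [hjk]
      · simp [hjk, Ne.symm hjk]
    simp only [h4]
    exact hasSum_ite_eq k _
  have hB := (orthonormal_fourier (T := (1 : ℝ))).sum_inner_products_le (L F)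
    (s := s.map Nat.castEmbedding)
  rw [Finset.sum_map] at hB
  have hnorm : ((‖L F‖ ^ 2 : ℝ) : ℂ) =
      ((∫ x in (0 : ℝ)..1, ‖h (r * exp (2 * Real.pi * x * I))‖ ^ 2 : ℝ) : ℂ) := by
    have e1 : ((‖L F‖ ^ 2 : ℝ) : ℂ) = inner ℂ (L F) (L F) := by
      rw [inner_self_eq_norm_sq_to_K]; simp
    rw [e1, hL, ContinuousMap.inner_toLp, AddCircle.integral_haarAddCircle,
      ← AddCircle.intervalIntegral_preimage 1 0, ← intervalIntegral.integral_ofReal]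
    simp only [inv_one, one_smul, zero_add]
    refine intervalIntegral.integral_congr fun x _ => ?_
    simp only [hFx, AddCircle.toCircle_apply_mk, Circle.coe_exp]
    rw [Complex.mul_conj, Complex.normSq_eq_norm_sq]
    push_cast
    simp
  rw [← Complex.ofReal_inj.1 hnorm]
  refine le_of_eq_of_le (Finset.sum_congr rfl fun k _ => ?_) hB
  rw [Nat.castEmbedding_apply, hin, norm_mul, norm_pow, Complex.norm_real, Real.norm_of_nonneg hr0]

lemma intervalIntegrable_abs_sin_rpow {s : ℝ} (hs : s < 1) (hs0 : 0 ≤ s) (a b : ℝ) :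
    IntervalIntegrable (fun x => |Real.sin x| ^ (-s)) volume a b := by
  have hmeas : Measurable fun x => |Real.sin x| ^ (-s) := by fun_prop
  have h1 : IntervalIntegrable (fun x => |Real.sin x| ^ (-s)) volume 0 (Real.pi / 2) := by
    have h2 : IntervalIntegrable (fun x : ℝ => (2 / Real.pi) ^ (-s) * x ^ (-s)) volume 0
        (Real.pi / 2) := (intervalIntegral.intervalIntegrable_rpow' (by linarith)).const_mul _
    refine h2.mono_fun hmeas.aestronglyMeasurable ?_
    rw [uIoc_of_le (by positivity)]
    filter_upwards [ae_restrict_mem measurableSet_Ioc] with x hx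
    have hsin := Real.mul_le_sin hx.1.le hx.2
    have hx0 : 0 < 2 / Real.pi * x := mul_pos (by positivity) hx.1
    rw [abs_of_pos (hx0.trans_le hsin), ← Real.mul_rpow (by positivity) hx.1.le,
      Real.norm_of_nonneg (Real.rpow_nonneg (hx0.le.trans hsin) _),
      Real.norm_of_nonneg (Real.rpow_nonneg hx0.le _)]
    exact Real.rpow_le_rpow_of_nonpos hx0 hsin (by linarith)
  have h3 : IntervalIntegrable (fun x => |Real.sin x| ^ (-s)) volume (Real.pi / 2) Real.pi := by
    have h4 := (h1.comp_sub_left Real.pi).symm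
    simpa [Real.sin_pi_sub, sub_half] using h4
  refine Function.Periodic.intervalIntegrable₀ (T := Real.pi) (fun x => ?_) Real.pi_ne_zero
    (h1.trans h3) a b
  simp [Real.sin_add_pi]

lemma abs_sin_le (ρ φ : ℝ) : |Real.sin φ| ≤ ‖1 - (ρ : ℂ) * exp (φ * I)‖ := by
  refine abs_le_of_sq_le_sq ?_ (norm_nonneg _)
  rw [← Complex.normSq_eq_norm_sq, Complex.normSq_apply]
  simp only [sub_re, one_re, re_ofReal_mul, exp_ofReal_mul_I_re, sub_im, one_im, im_ofReal_mul,
    exp_ofReal_mul_I_im]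
  nlinarith [Real.sin_sq_add_cos_sq φ, sq_nonneg (ρ - Real.cos φ)]

/-- An analytic function on the disk bounded by `K |1 - z²|^(-s)` with `s < 1/2` has square
summable Taylor coefficients. -/
lemma exists_sum_taylorCoeff_sq_le {s : ℝ} (hs0 : 0 ≤ s) (hs : s < 1 / 2) :
    ∃ C : ℝ, 0 < C ∧ ∀ (h : ℂ → ℂ) (K : ℝ), 0 ≤ K → DifferentiableOn ℂ h (Metric.ball 0 1) →
      (∀ z, ‖z‖ < 1 → ‖h z‖ ≤ K * ‖1 - z ^ 2‖ ^ (-s)) →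
      ∀ S : Finset ℕ, ∑ k ∈ S, ‖taylorCoeff h k‖ ^ 2 ≤ (C * K) ^ 2 := by
  set W : ℝ → ℝ := fun x => |Real.sin (4 * Real.pi * x)| ^ (-(2 * s)) with hW
  have hWi : IntervalIntegrable W volume 0 1 := by
    have := (intervalIntegrable_abs_sin_rpow (s := 2 * s) (by linarith) (by linarith) 0
      (4 * Real.pi)).comp_mul_left (c := 4 * Real.pi)
    simpa [hW, Real.pi_ne_zero] using this
  set J := ∫ x in (0 : ℝ)..1, W x with hJ
  have hJ0 : 0 ≤ J := intervalIntegral.integral_nonneg zero_le_one fun x _ => by positivity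
  refine ⟨Real.sqrt J + 1, by positivity, fun h K hK hd hb S => ?_⟩
  have hC : J * K ^ 2 ≤ ((Real.sqrt J + 1) * K) ^ 2 := by
    rw [mul_pow]
    gcongr
    nlinarith [Real.sq_sqrt hJ0, Real.sqrt_nonneg J]
  refine le_trans ?_ hC
  have key : ∀ r : ℝ, 0 ≤ r → r < 1 →
      ∑ k ∈ S, (‖taylorCoeff h k‖ * r ^ k) ^ 2 ≤ J * K ^ 2 := by
    intro r hr0 hr1
    refine (sum_taylorCoeff_sq_le_integral hd hr0 hr1 S).trans ?_
    rw [hJ, ← intervalIntegral.integral_mul_const]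
    have hlt : ∀ x : ℝ, ‖(r : ℂ) * exp (2 * Real.pi * x * I)‖ < 1 := by
      intro x
      have : (2 * Real.pi * x * I : ℂ) = ((2 * Real.pi * x : ℝ) : ℂ) * I := by push_cast; ring
      rw [norm_mul, this, Complex.norm_exp_ofReal_mul_I, mul_one, Complex.norm_real,
        Real.norm_of_nonneg hr0]
      exact hr1
    refine intervalIntegral.integral_mono_ae zero_le_one ?_ (hWi.mul_const _) ?_
    · refine Continuous.intervalIntegrable ?_ _ _
      have : Continuous fun x : ℝ => h (r * exp (2 * Real.pi * x * I)) :=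
        hd.continuousOn.comp_continuous (by fun_prop) fun x => mem_ball_zero_iff.2 (hlt x)
      exact this.norm.pow 2
    · have hcount : Set.Countable {x : ℝ | Real.sin (4 * Real.pi * x) = 0} := by
        refine (Set.countable_range fun n : ℤ => (n : ℝ) / 4).mono fun x hx => ?_
        obtain ⟨n, hn⟩ := Real.sin_eq_zero_iff.1 hx
        refine ⟨n, ?_⟩
        have : (n : ℝ) = 4 * x := mul_right_cancel₀ Real.pi_ne_zero (by linarith)
        simp only [this]
        ring
      filter_upwards [hcount.ae_notMem volume] with x hx
      have hpos : 0 < |Real.sin (4 * Real.pi * x)| := abs_pos.2 hx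
      have hle : |Real.sin (4 * Real.pi * x)| ≤
          ‖1 - ((r : ℂ) * exp (2 * Real.pi * x * I)) ^ 2‖ := by
        convert abs_sin_le (r ^ 2) (4 * Real.pi * x) using 3
        rw [mul_pow, ← Complex.exp_nat_mul]
        push_cast
        ring_nf
      calc ‖h (r * exp (2 * Real.pi * x * I))‖ ^ 2
          ≤ (K * |Real.sin (4 * Real.pi * x)| ^ (-s)) ^ 2 := by
            gcongr
            refine (hb _ (hlt x)).trans ?_
            gcongr ?_ * ?_
            exact Real.rpow_le_rpow_of_nonpos hpos hle (by linarith)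
        _ = W x * K ^ 2 := by
            rw [mul_pow, ← Real.rpow_natCast (_ ^ (-s)) 2, ← Real.rpow_mul hpos.le, mul_comm, hW]
            congr 2
            push_cast
            ring
  have hcont : Tendsto (fun r : ℝ => ∑ k ∈ S, (‖taylorCoeff h k‖ * r ^ k) ^ 2) (𝓝[<] 1)
      (𝓝 (∑ k ∈ S, (‖taylorCoeff h k‖ * 1 ^ k) ^ 2)) :=
    (Continuous.tendsto (by fun_prop) 1).mono_left nhdsWithin_le_nhds
  simp only [one_pow, mul_one] at hcont
  refine le_of_tendsto hcont ?_
  filter_upwards [Ioo_mem_nhdsLT (show (0 : ℝ) < 1 by norm_num)] with r hr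
  exact key r hr.1.le hr.2

/-! ### A Schwarz lemma with several zeros -/

lemma norm_dslope_le_div {F : ℂ → ℂ} {r η B : ℝ}
    (hd : DifferentiableOn ℂ F (Metric.ball 0 r)) (hB : ∀ z ∈ Metric.ball (0 : ℂ) r, ‖F z‖ ≤ B)
    {e : ℂ} (he : ‖e‖ ≤ η) (hη : η < r) (hFe : F e = 0) {z : ℂ} (hz : z ∈ Metric.ball (0 : ℂ) r) :
    ‖dslope F e z‖ ≤ B / (r - η) := by
  have her : e ∈ Metric.ball (0 : ℂ) r := mem_ball_zero_iff.2 (he.trans_lt hη)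
  have hG := (Complex.differentiableOn_dslope (Metric.isOpen_ball.mem_nhds her)).2 hd
  rw [le_div_iff₀ (by linarith)]
  have hlim : Tendsto (fun t : ℝ => ‖dslope F e z‖ * (t - η)) (𝓝[<] r)
      (𝓝 (‖dslope F e z‖ * (r - η))) :=
    (Continuous.tendsto (by fun_prop) r).mono_left nhdsWithin_le_nhds
  refine le_of_tendsto hlim ?_
  filter_upwards [Ioo_mem_nhdsLT (max_lt (mem_ball_zero_iff.1 hz) hη)] with t ht
  have hzt : ‖z‖ < t := (le_max_left _ _).trans_lt ht.1
  have hηt : η < t := (le_max_right _ _).trans_lt ht.1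
  have ht0 : t ≠ 0 := ((norm_nonneg z).trans_lt hzt).ne'
  rw [← le_div_iff₀ (by linarith)]
  have hsub : Metric.closedBall (0 : ℂ) t ⊆ Metric.ball 0 r := Metric.closedBall_subset_ball ht.2
  refine Complex.norm_le_of_forall_mem_frontier_norm_le (U := Metric.ball 0 t)
    Metric.isBounded_ball ?_ ?_ (subset_closure (mem_ball_zero_iff.2 hzt))
  · refine DifferentiableOn.diffContOnCl ?_
    rw [closure_ball _ ht0]
    exact hG.mono hsub
  · intro w hw
    rw [frontier_ball _ ht0, mem_sphere_zero_iff_norm] at hw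
    have hwe : t - η ≤ ‖w - e‖ := by linarith [norm_sub_norm_le w e]
    have hne : w ≠ e := fun h => by simp [h] at hwe; linarith
    have h1 := sub_smul_dslope F e w
    rw [hFe, sub_zero] at h1
    have h2 := hB w (hsub (by simp [hw]))
    rw [← h1, norm_smul] at h2
    rw [le_div_iff₀ (by linarith), mul_comm]
    exact (mul_le_mul_of_nonneg_right hwe (norm_nonneg _)).trans h2

lemma norm_le_mul_prod_of_zeros {r η : ℝ} (hη : η < r) (S : Finset ℂ) :
    ∀ (F : ℂ → ℂ) (B : ℝ), DifferentiableOn ℂ F (Metric.ball 0 r) →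
      (∀ z ∈ Metric.ball (0 : ℂ) r, ‖F z‖ ≤ B) → (∀ e ∈ S, ‖e‖ ≤ η ∧ F e = 0) →
      ∀ z ∈ Metric.ball (0 : ℂ) r, ‖F z‖ ≤ B * ((‖z‖ + η) / (r - η)) ^ S.card := by
  induction S using Finset.induction_on with
  | empty =>
    intro F B _ hB _ z hz
    simpa using hB z hz
  | insert e S heS ih =>
    intro F B hd hB hS z hz
    obtain ⟨he, hFe⟩ := hS e (Finset.mem_insert_self _ _)
    have her : e ∈ Metric.ball (0 : ℂ) r := mem_ball_zero_iff.2 (he.trans_lt hη)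
    have h := ih (dslope F e) (B / (r - η))
      ((Complex.differentiableOn_dslope (Metric.isOpen_ball.mem_nhds her)).2 hd)
      (fun w hw => norm_dslope_le_div hd hB he hη hFe hw)
      (fun e' he' => by
        obtain ⟨h1, h2⟩ := hS e' (Finset.mem_insert_of_mem he')
        have hne : e' ≠ e := fun h => heS (h ▸ he')
        exact ⟨h1, by rw [dslope_of_ne _ hne, slope_def_field, h2, hFe]; simp⟩) z hz
    have h1 := sub_smul_dslope F e z
    rw [hFe, sub_zero] at h1
    rw [← h1, norm_smul, Finset.card_insert_of_notMem heS]
    have h2 : ‖z - e‖ ≤ ‖z‖ + η := (norm_sub_le _ _).trans (by linarith)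
    calc ‖z - e‖ * ‖dslope F e z‖
        ≤ (‖z‖ + η) * (B / (r - η) * ((‖z‖ + η) / (r - η)) ^ S.card) :=
          mul_le_mul h2 h (norm_nonneg _) ((norm_nonneg _).trans h2)
      _ = _ := by ring

/-! ### Möbius maps with a real parameter -/

/-- The automorphism of the disk sending `0` to the real point `p`. -/
def realMoebius (p : ℝ) (ζ : ℂ) : ℂ := (ζ + p) / (1 + p * ζ)

lemma one_sub_le_norm_one_add_mul {p : ℝ} (hp : |p| < 1) (ζ : ℂ) :
    1 - ‖ζ‖ ≤ ‖1 + p * ζ‖ := by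
  have h1 : ‖(p : ℂ) * ζ‖ ≤ ‖ζ‖ := by
    rw [norm_mul, Complex.norm_real, Real.norm_eq_abs]
    exact mul_le_of_le_one_left (norm_nonneg _) hp.le
  have h2 := norm_sub_norm_le (1 : ℂ) (-(p * ζ))
  rw [norm_neg, sub_neg_eq_add, norm_one] at h2
  linarith

lemma one_add_mul_ne_zero {p : ℝ} (hp : |p| < 1) {ζ : ℂ} (hζ : ‖ζ‖ < 1) :
    (1 + p * ζ : ℂ) ≠ 0 := by
  have := one_sub_le_norm_one_add_mul hp ζ
  exact norm_pos_iff.1 (by linarith)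

lemma one_sub_norm_realMoebius_sq {p : ℝ} (hp : |p| < 1) {ζ : ℂ} (hζ : ‖ζ‖ < 1) :
    (1 - ‖realMoebius p ζ‖ ^ 2) * ‖1 + p * ζ‖ ^ 2 = (1 - p ^ 2) * (1 - ‖ζ‖ ^ 2) := by
  have h0 : ‖(1 + p * ζ : ℂ)‖ ≠ 0 := norm_ne_zero_iff.2 (one_add_mul_ne_zero hp hζ)
  rw [realMoebius, norm_div, sub_mul, div_pow, div_mul_cancel₀ _ (pow_ne_zero 2 h0)]
  simp only [← Complex.normSq_eq_norm_sq, Complex.normSq_apply]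
  simp
  ring

lemma norm_realMoebius_lt_one {p : ℝ} (hp : |p| < 1) {ζ : ℂ} (hζ : ‖ζ‖ < 1) :
    ‖realMoebius p ζ‖ < 1 := by
  have h := one_sub_norm_realMoebius_sq hp hζ
  have h0 : 0 < ‖(1 + p * ζ : ℂ)‖ := norm_pos_iff.2 (one_add_mul_ne_zero hp hζ)
  have h1 : 0 < 1 - p ^ 2 := by nlinarith [sq_abs p, abs_nonneg p]
  have h2 : 0 < 1 - ‖ζ‖ ^ 2 := by nlinarith [norm_nonneg ζ]
  have h3 : 0 < 1 - ‖realMoebius p ζ‖ ^ 2 :=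
    pos_of_mul_pos_left (h ▸ mul_pos h1 h2) (by positivity)
  nlinarith [norm_nonneg (realMoebius p ζ)]

lemma differentiableOn_realMoebius {p : ℝ} (hp : |p| < 1) :
    DifferentiableOn ℂ (realMoebius p) (Metric.ball 0 1) := by
  intro z hz
  have := one_add_mul_ne_zero hp (mem_ball_zero_iff.1 hz)
  unfold realMoebius
  exact DifferentiableWithinAt.div (by fun_prop) (by fun_prop) this

/-- If the diagonal restriction of `a` vanishes at `M` suitable points near `p`, then it is
exponentially small in `M` on a hyperbolic disk centred at `p`. -/
lemma exists_norm_diagEval_realMoebius_le (N : ℕ) {q : ℝ} (hq0 : 0 ≤ q) (hq1 : q < 1) :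
    ∃ K > (0 : ℝ), ∃ κ : ℝ, 0 < κ ∧ κ < 1 ∧ ∃ e : ℕ → ℂ, (∀ i, ‖e i‖ < 1) ∧
      ∀ (a : H2poly N) (p : ℝ) (M : ℕ), |p| < 1 →
        (∀ i < M, diagEval a (realMoebius p (e i)) = 0) → ∀ ζ : ℂ, ‖ζ‖ ≤ q →
        ‖diagEval a (realMoebius p ζ)‖ ≤
          K * κ ^ M * ((1 - ‖realMoebius p ζ‖ ^ 2) ^ (-(N : ℝ) / 2) * ‖a‖) := by
  set η := (1 - q) / 8 with hη
  set r := (1 + q) / 2 with hr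
  set D := (1 - q) ^ 2 * (1 - r ^ 2) / 4 with hD
  have hη0 : 0 < η := by linarith
  have hr1 : r < 1 := by linarith
  have hr0 : 0 < r := by linarith
  have hD0 : 0 < D := by
    have : 0 < 1 - r ^ 2 := by nlinarith
    have : 0 < 1 - q := by linarith
    positivity
  have hrη : 0 < r - η := by linarith
  refine ⟨D ^ (-(N : ℝ) / 2), by positivity, (q + η) / (r - η), by positivity,
    (div_lt_one hrη).2 (by linarith), fun i => ((η / (i + 1) : ℝ) : ℂ), ?_, ?_⟩
  · intro i
    rw [Complex.norm_real, Real.norm_of_nonneg (by positivity)]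
    exact (div_le_self hη0.le (by linarith [(Nat.cast_nonneg i : (0 : ℝ) ≤ i)])).trans_lt
      (by linarith)
  · intro a p M hp hzero ζ hζ
    set w := realMoebius p ζ with hw
    have hζ1 : ‖ζ‖ < 1 := hζ.trans_lt hq1
    have hw1 := norm_realMoebius_lt_one hp hζ1
    rw [← hw] at hw1
    have hW : 0 < 1 - ‖w‖ ^ 2 := by nlinarith [norm_nonneg w]
    have hp2 : 0 < 1 - p ^ 2 := by nlinarith [sq_abs p, abs_nonneg p]
    have hpw : (1 - q) ^ 2 * (1 - ‖w‖ ^ 2) ≤ 1 - p ^ 2 := by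
      have h1 := one_sub_norm_realMoebius_sq hp hζ1
      have h2 := one_sub_le_norm_one_add_mul hp ζ
      rw [← hw] at h1
      have h3 : (1 - q) ^ 2 ≤ ‖1 + p * ζ‖ ^ 2 := by
        have : 0 ≤ 1 - q := by linarith
        gcongr
        linarith
      nlinarith [mul_le_mul_of_nonneg_left h3 hW.le, mul_nonneg hp2.le (sq_nonneg ‖ζ‖)]
    set B := D ^ (-(N : ℝ) / 2) * ((1 - ‖w‖ ^ 2) ^ (-(N : ℝ) / 2) * ‖a‖) with hB
    set S : Finset ℂ := (Finset.range M).image fun i : ℕ => ((η / (i + 1) : ℝ) : ℂ) with hS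
    have hcard : S.card = M := by
      rw [hS, Finset.card_image_of_injective, Finset.card_range]
      intro i j hij
      have h1 : η / ((i : ℝ) + 1) = η / ((j : ℝ) + 1) := Complex.ofReal_inj.1 hij
      rw [div_eq_div_iff (by positivity) (by positivity)] at h1
      have h2 := mul_left_cancel₀ hη0.ne' h1
      exact_mod_cast (add_right_cancel h2).symm
    have hmaps : ∀ z ∈ Metric.ball (0 : ℂ) r, ‖z‖ < 1 := fun z hz =>
      (mem_ball_zero_iff.1 hz).trans hr1
    have h := norm_le_mul_prod_of_zeros (r := r) (η := η) (by linarith) S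
      (fun z => diagEval a (realMoebius p z)) B ?_ ?_ ?_ ζ (mem_ball_zero_iff.2 (by linarith))
    · refine h.trans ?_
      rw [hcard, hB]
      have : 0 ≤ D ^ (-(N : ℝ) / 2) * ((1 - ‖w‖ ^ 2) ^ (-(N : ℝ) / 2) * ‖a‖) := by positivity
      calc _ ≤ D ^ (-(N : ℝ) / 2) * ((1 - ‖w‖ ^ 2) ^ (-(N : ℝ) / 2) * ‖a‖) *
            ((q + η) / (r - η)) ^ M := by gcongr
        _ = _ := by ring
    · exact (differentiableOn_diagEval a).comp
        ((differentiableOn_realMoebius hp).mono (Metric.ball_subset_ball hr1.le))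
        fun z hz => mem_ball_zero_iff.2 (norm_realMoebius_lt_one hp (hmaps z hz))
    · intro z hz
      refine (norm_diagEval_le (norm_realMoebius_lt_one hp (hmaps z hz)) a).trans ?_
      rw [hB, ← mul_assoc, ← Real.mul_rpow hD0.le hW.le]
      refine mul_le_mul_of_nonneg_right ?_ (norm_nonneg _)
      refine Real.rpow_le_rpow_of_nonpos (by positivity) ?_
        (by linarith [(Nat.cast_nonneg N : (0 : ℝ) ≤ N)])
      have h1 := one_sub_norm_realMoebius_sq hp (hmaps z hz)
      have hz' := mem_ball_zero_iff.1 hz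
      have h2 : ‖1 + p * z‖ ≤ 2 := by
        refine (norm_add_le _ _).trans ?_
        rw [norm_one, norm_mul, Complex.norm_real, Real.norm_eq_abs]
        nlinarith [norm_nonneg z, abs_nonneg p]
      have h3 : 0 < 1 - ‖realMoebius p z‖ ^ 2 := by
        nlinarith [norm_nonneg (realMoebius p z), norm_realMoebius_lt_one hp (hmaps z hz)]
      have h4 : ‖1 + p * z‖ ^ 2 ≤ 4 := by nlinarith [norm_nonneg (1 + p * z)]
      have h5 : 1 - r ^ 2 ≤ 1 - ‖z‖ ^ 2 := by nlinarith [norm_nonneg z]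
      have h6 : 0 < 1 - r ^ 2 := by nlinarith
      have h7 : (1 - q) ^ 2 * (1 - ‖w‖ ^ 2) * (1 - r ^ 2) ≤ (1 - p ^ 2) * (1 - ‖z‖ ^ 2) :=
        mul_le_mul hpw h5 h6.le hp2.le
      have h8 := mul_le_mul_of_nonneg_left h4 h3.le
      rw [hD]
      linarith
    · intro e' he'
      obtain ⟨i, hi, rfl⟩ := Finset.mem_image.1 he'
      refine ⟨?_, hzero i (Finset.mem_range.1 hi)⟩
      rw [Complex.norm_real, Real.norm_of_nonneg (by positivity)]
      exact div_le_self hη0.le (by linarith [(Nat.cast_nonneg i : (0 : ℝ) ≤ i)])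

/-! ### Geometry of the lens map -/

section LensGeometry

variable {θ : ℝ} {z : ℂ}

lemma one_add_re_pos (hz : ‖z‖ < 1) : 0 < (1 + z).re := by
  have := (abs_le.1 (Complex.abs_re_le_norm z)).1
  simp only [add_re, one_re]
  linarith

lemma one_sub_re_pos (hz : ‖z‖ < 1) : 0 < (1 - z).re := by
  have := (abs_le.1 (Complex.abs_re_le_norm z)).2
  simp only [sub_re, one_re]
  linarith

lemma cos_pi_mul_pos (h0 : 0 < θ) (h1 : θ < 1 / 2) : 0 < Real.cos (Real.pi * θ) :=
  Real.cos_pos_of_mem_Ioo ⟨by nlinarith [Real.pi_pos], by nlinarith [Real.pi_pos]⟩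

/-- The half-plane estimate behind the lens map: powers of points of the right half-plane stay
in a sector. -/
lemma cos_mul_norm_le_re_mul_conj (h0 : 0 < θ) (h1 : θ < 1 / 2) {u v : ℂ} (hu : 0 < u.re)
    (hv : 0 < v.re) :
    Real.cos (Real.pi * θ) * (‖u ^ (θ : ℂ)‖ * ‖v ^ (θ : ℂ)‖) ≤
      (u ^ (θ : ℂ)).re * (v ^ (θ : ℂ)).re + (u ^ (θ : ℂ)).im * (v ^ (θ : ℂ)).im := by
  rw [Complex.norm_cpow_real, Complex.norm_cpow_real, Complex.cpow_ofReal_re,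
    Complex.cpow_ofReal_re, Complex.cpow_ofReal_im, Complex.cpow_ofReal_im]
  have hau := abs_lt.1 (Complex.abs_arg_lt_pi_div_two_iff.2 (Or.inl hu))
  have hav := abs_lt.1 (Complex.abs_arg_lt_pi_div_two_iff.2 (Or.inl hv))
  have hcos : Real.cos (Real.pi * θ) ≤ Real.cos (arg u * θ - arg v * θ) := by
    rw [← Real.cos_abs (arg u * θ - arg v * θ)]
    refine Real.cos_le_cos_of_nonneg_of_le_pi (abs_nonneg _) (by nlinarith [Real.pi_pos]) ?_
    rw [← sub_mul, abs_mul, abs_of_pos h0]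
    exact mul_le_mul_of_nonneg_right (abs_le.2 ⟨by linarith, by linarith⟩) h0.le
  rw [Real.cos_sub] at hcos
  have := mul_le_mul_of_nonneg_left hcos
    (show 0 ≤ ‖u‖ ^ θ * ‖v‖ ^ θ by positivity)
  linarith

lemma norm_add_real_mul_sq (a b : ℂ) (t : ℝ) :
    ‖a + t * b‖ ^ 2 = ‖a‖ ^ 2 + t ^ 2 * ‖b‖ ^ 2 + 2 * t * (a.re * b.re + a.im * b.im) := by
  simp only [← Complex.normSq_eq_norm_sq, Complex.normSq_apply]
  simp
  ring

lemma norm_rpow_le_two (h0 : 0 < θ) (h1 : θ < 1 / 2) {u : ℂ} (hu : ‖u‖ ≤ 2) :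
    ‖u ^ (θ : ℂ)‖ ≤ 2 := by
  rw [Complex.norm_cpow_real]
  calc ‖u‖ ^ θ ≤ (2 : ℝ) ^ θ := Real.rpow_le_rpow (norm_nonneg _) hu h0.le
    _ ≤ (2 : ℝ) ^ (1 : ℝ) := Real.rpow_le_rpow_of_exponent_le (by norm_num) (by linarith)
    _ = 2 := Real.rpow_one 2

lemma norm_cpow_pos {u : ℂ} (hu : 0 < u.re) : 0 < ‖u ^ (θ : ℂ)‖ := by
  rw [Complex.norm_cpow_real]
  have : u ≠ 0 := fun h => by simp [h] at hu
  positivity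

lemma norm_cpow_mul_norm_cpow (z : ℂ) :
    ‖(1 + z) ^ (θ : ℂ)‖ * ‖(1 - z) ^ (θ : ℂ)‖ = ‖1 - z ^ 2‖ ^ θ := by
  rw [Complex.norm_cpow_real, Complex.norm_cpow_real, ← Real.mul_rpow (norm_nonneg _)
    (norm_nonneg _), ← norm_mul]
  ring_nf

lemma norm_one_add_le_two (hz : ‖z‖ < 1) : ‖1 + z‖ ≤ 2 :=
  (norm_add_le _ _).trans (by rw [norm_one]; linarith)

lemma norm_one_sub_le_two (hz : ‖z‖ < 1) : ‖1 - z‖ ≤ 2 :=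
  (norm_sub_le _ _).trans (by rw [norm_one]; linarith)

lemma cpow_add_real_mul_cpow_ne_zero (h0 : 0 < θ) (h1 : θ < 1 / 2) (hz : ‖z‖ < 1) {t : ℝ}
    (ht : 0 < t) : (1 + z) ^ (θ : ℂ) + t * (1 - z) ^ (θ : ℂ) ≠ 0 := by
  have hX := cos_mul_norm_le_re_mul_conj h0 h1 (one_add_re_pos hz) (one_sub_re_pos hz)
  have hc := cos_pi_mul_pos h0 h1
  have hP := norm_cpow_pos (θ := θ) (one_add_re_pos hz)
  have hQ := norm_cpow_pos (θ := θ) (one_sub_re_pos hz)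
  have h := norm_add_real_mul_sq ((1 + z) ^ (θ : ℂ)) ((1 - z) ^ (θ : ℂ)) t
  intro h'
  rw [h'] at h
  have : 0 < 2 * t * (((1 + z) ^ (θ : ℂ)).re * ((1 - z) ^ (θ : ℂ)).re +
      ((1 + z) ^ (θ : ℂ)).im * ((1 - z) ^ (θ : ℂ)).im) :=
    mul_pos (by positivity) (lt_of_lt_of_le (by positivity) hX)
  have : 0 < ‖(1 + z) ^ (θ : ℂ)‖ ^ 2 := by positivity
  have : 0 ≤ t ^ 2 * ‖(1 - z) ^ (θ : ℂ)‖ ^ 2 := by positivity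
  simp only [norm_zero] at h
  linarith

lemma cos_div_mul_le_one_sub_norm_lens_sq (h0 : 0 < θ) (h1 : θ < 1 / 2) (hz : ‖z‖ < 1) :
    Real.cos (Real.pi * θ) / 4 * ‖1 - z ^ 2‖ ^ θ ≤ 1 - ‖lens θ z‖ ^ 2 := by
  have hX := cos_mul_norm_le_re_mul_conj h0 h1 (one_add_re_pos hz) (one_sub_re_pos hz)
  have hc := cos_pi_mul_pos h0 h1
  have hP := norm_rpow_le_two h0 h1 (norm_one_add_le_two hz)
  have hQ := norm_rpow_le_two h0 h1 (norm_one_sub_le_two hz)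
  have hne := cpow_add_real_mul_cpow_ne_zero h0 h1 hz one_pos
  rw [← norm_cpow_mul_norm_cpow, lens]
  have hp := norm_add_real_mul_sq ((1 + z) ^ (θ : ℂ)) ((1 - z) ^ (θ : ℂ)) 1
  have hm := norm_add_real_mul_sq ((1 + z) ^ (θ : ℂ)) ((1 - z) ^ (θ : ℂ)) (-1)
  rw [ofReal_one, one_mul] at hp hne
  rw [ofReal_neg, ofReal_one, neg_one_mul, ← sub_eq_add_neg] at hm
  generalize (1 + z) ^ (θ : ℂ) = a at *
  generalize (1 - z) ^ (θ : ℂ) = b at *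
  have hpos : 0 < ‖a + b‖ ^ 2 := by positivity
  have hle : ‖a + b‖ ^ 2 ≤ 16 := by
    have : ‖a + b‖ ≤ 4 := (norm_add_le _ _).trans (by linarith)
    nlinarith [norm_nonneg (a + b)]
  rw [norm_div, div_pow, one_sub_div hpos.ne', le_div_iff₀ hpos]
  have : 0 ≤ Real.cos (Real.pi * θ) * (‖a‖ * ‖b‖) := by positivity
  nlinarith [mul_le_mul_of_nonneg_left hle this]

lemma norm_one_sub_sq_pos (hz : ‖z‖ < 1) : 0 < ‖1 - z ^ 2‖ := by
  have h := norm_sub_norm_le (1 : ℂ) (z ^ 2)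
  rw [norm_one, norm_pow] at h
  nlinarith [norm_nonneg z]

lemma norm_lens_lt_one (h0 : 0 < θ) (h1 : θ < 1 / 2) (hz : ‖z‖ < 1) : ‖lens θ z‖ < 1 := by
  have h := cos_div_mul_le_one_sub_norm_lens_sq h0 h1 hz
  have hc := cos_pi_mul_pos h0 h1
  have hu := norm_one_sub_sq_pos hz
  have : 0 < Real.cos (Real.pi * θ) / 4 * ‖1 - z ^ 2‖ ^ θ := by positivity
  nlinarith [norm_nonneg (lens θ z)]

lemma differentiableOn_lens (h0 : 0 < θ) (h1 : θ < 1 / 2) :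
    DifferentiableOn ℂ (lens θ) (Metric.ball 0 1) := by
  intro z hz
  rw [mem_ball_zero_iff] at hz
  have hne := cpow_add_real_mul_cpow_ne_zero h0 h1 hz one_pos
  rw [ofReal_one, one_mul] at hne
  have ha : DifferentiableAt ℂ (fun z : ℂ => (1 + z) ^ (θ : ℂ)) z :=
    DifferentiableAt.cpow_const (by fun_prop) (Or.inl (one_add_re_pos hz))
  have hb : DifferentiableAt ℂ (fun z : ℂ => (1 - z) ^ (θ : ℂ)) z :=
    DifferentiableAt.cpow_const (by fun_prop) (Or.inl (one_sub_re_pos hz))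
  exact ((ha.sub hb).div (ha.add hb) hne).differentiableWithinAt

/-- The real points `tanh (j / 2)`, at unit hyperbolic distance (up to normalization) from each
other. -/
def lensCenter (j : ℤ) : ℝ := (Real.exp j - 1) / (Real.exp j + 1)

lemma abs_lensCenter_lt_one (j : ℤ) : |lensCenter j| < 1 := by
  have h := Real.exp_pos j
  rw [lensCenter, abs_div, abs_of_pos (by linarith : 0 < Real.exp j + 1),
    div_lt_one (by linarith), abs_lt]
  exact ⟨by linarith, by linarith⟩

/-- The radius of the hyperbolic disks that cover the lens. -/
def lensRadius (θ : ℝ) : ℝ :=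
  Real.sqrt ((2 - Real.cos (Real.pi * θ)) / (2 + Real.cos (Real.pi * θ)))

lemma lensRadius_lt_one (h0 : 0 < θ) (h1 : θ < 1 / 2) : lensRadius θ < 1 := by
  have hc := cos_pi_mul_pos h0 h1
  rw [lensRadius, Real.sqrt_lt' one_pos, one_pow, div_lt_one (by linarith)]
  linarith

lemma exists_lens_eq_realMoebius (h0 : 0 < θ) (h1 : θ < 1 / 2) (hz : ‖z‖ < 1) (j : ℤ)
    (hl : Real.exp j * ‖(1 - z) ^ (θ : ℂ)‖ ≤ ‖(1 + z) ^ (θ : ℂ)‖)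
    (hu : ‖(1 + z) ^ (θ : ℂ)‖ ≤ 3 * (Real.exp j * ‖(1 - z) ^ (θ : ℂ)‖)) :
    ∃ ζ : ℂ, ‖ζ‖ ≤ lensRadius θ ∧ lens θ z = realMoebius (lensCenter j) ζ := by
  have hE : 0 < Real.exp j := Real.exp_pos _
  have hX := cos_mul_norm_le_re_mul_conj h0 h1 (one_add_re_pos hz) (one_sub_re_pos hz)
  have hc := cos_pi_mul_pos h0 h1
  have hc1 := Real.cos_le_one (Real.pi * θ)
  have hne1 := cpow_add_real_mul_cpow_ne_zero h0 h1 hz one_pos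
  have hne := cpow_add_real_mul_cpow_ne_zero h0 h1 hz hE
  have hp := norm_add_real_mul_sq ((1 + z) ^ (θ : ℂ)) ((1 - z) ^ (θ : ℂ)) (Real.exp j)
  have hm := norm_add_real_mul_sq ((1 + z) ^ (θ : ℂ)) ((1 - z) ^ (θ : ℂ)) (-Real.exp j)
  rw [ofReal_one, one_mul] at hne1
  rw [ofReal_neg, neg_mul, ← sub_eq_add_neg] at hm
  rw [lens, lensRadius, lensCenter]
  generalize (1 + z) ^ (θ : ℂ) = a at *
  generalize (1 - z) ^ (θ : ℂ) = b at *
  generalize Real.exp j = E at *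
  generalize Real.cos (Real.pi * θ) = c at *
  refine ⟨(a - E * b) / (a + E * b), ?_, ?_⟩
  · refine Real.le_sqrt_of_sq_le ?_
    have hpos : 0 < ‖a + E * b‖ ^ 2 := by positivity
    rw [norm_div, div_pow, div_le_div_iff₀ hpos (by linarith), hm, hp]
    have h2 : ‖a‖ ^ 2 + E ^ 2 * ‖b‖ ^ 2 ≤ 4 * (E * (‖a‖ * ‖b‖)) := by
      nlinarith [mul_nonneg (sub_nonneg.2 hl) (sub_nonneg.2 hu), norm_nonneg a, norm_nonneg b,
        mul_nonneg hE.le (norm_nonneg b)]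
    nlinarith [mul_le_mul_of_nonneg_left h2 hc.le, mul_le_mul_of_nonneg_left hX hE.le]
  · have hE1 : (E : ℂ) + 1 ≠ 0 := by
      have : E + 1 ≠ 0 := by linarith
      exact_mod_cast this
    have hnum : (a - E * b) / (a + E * b) + (((E - 1) / (E + 1) : ℝ) : ℂ) =
        2 * E * (a - b) / ((a + E * b) * (E + 1)) := by
      push_cast
      field_simp
      ring
    have hden : 1 + (((E - 1) / (E + 1) : ℝ) : ℂ) * ((a - E * b) / (a + E * b)) =
        2 * E * (a + b) / ((a + E * b) * (E + 1)) := by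
      push_cast
      field_simp
      ring
    have hE0 : (E : ℂ) ≠ 0 := by exact_mod_cast hE.ne'
    rw [realMoebius, hnum, hden, div_div_div_cancel_right₀ (mul_ne_zero hne hE1),
      mul_div_mul_left _ _ (mul_ne_zero two_ne_zero hE0)]

/-- The part of the lens away from its corners is covered by `2 M + 1` hyperbolic disks. -/
lemma exists_lens_eq_realMoebius_or_le (h0 : 0 < θ) (h1 : θ < 1 / 2) (hz : ‖z‖ < 1) (M : ℕ) :
    (∃ j ∈ Finset.Icc (-(M : ℤ)) M, ∃ ζ : ℂ, ‖ζ‖ ≤ lensRadius θ ∧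
      lens θ z = realMoebius (lensCenter j) ζ) ∨ ‖1 - z ^ 2‖ ^ θ ≤ 4 * Real.exp (-M) := by
  have hP := norm_cpow_pos (θ := θ) (one_add_re_pos hz)
  have hQ := norm_cpow_pos (θ := θ) (one_sub_re_pos hz)
  have hP2 := norm_rpow_le_two h0 h1 (norm_one_add_le_two hz)
  have hQ2 := norm_rpow_le_two h0 h1 (norm_one_sub_le_two hz)
  have hlog := Real.exp_log (div_pos hP hQ)
  have key := exists_lens_eq_realMoebius h0 h1 hz
  rw [← norm_cpow_mul_norm_cpow]
  generalize ‖(1 + z) ^ (θ : ℂ)‖ = P at *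
  generalize ‖(1 - z) ^ (θ : ℂ)‖ = Q at *
  generalize Real.log (P / Q) = x at *
  have hPQ : P = Real.exp x * Q := by rw [hlog]; field_simp
  rcases le_or_gt |x| M with hx | hx
  · left
    rw [abs_le] at hx
    have hf1 := Int.floor_le x
    have hf2 := Int.lt_floor_add_one x
    refine ⟨⌊x⌋, Finset.mem_Icc.2 ⟨?_, ?_⟩, key _ ?_ ?_⟩
    · exact Int.le_floor.2 (by push_cast; exact hx.1)
    · exact_mod_cast hf1.trans hx.2
    · rw [hPQ]
      gcongr
    · rw [hPQ, ← mul_assoc]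
      gcongr
      calc Real.exp x ≤ Real.exp (1 + ⌊x⌋) := Real.exp_le_exp.2 (by linarith)
        _ = Real.exp 1 * Real.exp ⌊x⌋ := Real.exp_add _ _
        _ ≤ 3 * Real.exp ⌊x⌋ := by
          gcongr
          linarith [Real.exp_one_lt_d9]
  · right
    rcases lt_abs.1 hx with h | h
    · have h2 : Q ≤ Real.exp (-M) * P := by
        rw [hPQ, ← mul_assoc, ← Real.exp_add]
        exact le_mul_of_one_le_left hQ.le (Real.one_le_exp (by linarith))
      calc P * Q ≤ P * (Real.exp (-M) * P) := by gcongr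
        _ ≤ 2 * (Real.exp (-M) * 2) := by gcongr
        _ = _ := by ring
    · have h2 : P ≤ Real.exp (-M) * Q := by
        rw [hPQ]
        gcongr
        linarith
      calc P * Q ≤ Real.exp (-M) * Q * Q := by gcongr
        _ ≤ Real.exp (-M) * 2 * 2 := by gcongr
        _ = _ := by ring

end LensGeometry

/-! ### Growth of `a ∘ Φ` -/

/-- Growth of the composition, with an exponential gain when the diagonal restriction vanishes
at `(2 M + 1) M` suitable points. -/
lemma exists_norm_diagEval_lens_le {N : ℕ} {θ : ℝ} (h0 : 0 < θ) (h1 : θ < 1 / 2)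
    (hN : θ * N < 1) :
    ∃ s K d : ℝ, 0 ≤ s ∧ s < 1 / 2 ∧ 0 < K ∧ 0 < d ∧ ∃ e : ℕ → ℂ, (∀ i, ‖e i‖ < 1) ∧
      ∀ (a : H2poly N) (M : ℕ),
        (∀ j ∈ Finset.Icc (-(M : ℤ)) M, ∀ i < M,
          diagEval a (realMoebius (lensCenter j) (e i)) = 0) → ∀ z : ℂ, ‖z‖ < 1 →
        ‖diagEval a (lens θ z)‖ ≤ K * Real.exp (-d * M) * ‖a‖ * ‖1 - z ^ 2‖ ^ (-s) := by
  obtain ⟨K₁, hK₁, κ, hκ0, hκ1, e, he, hloc⟩ :=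
    exists_norm_diagEval_realMoebius_le N (Real.sqrt_nonneg _) (lensRadius_lt_one h0 h1)
  set δ : ℝ := (1 / 2 - θ * N / 2) / (2 * θ) with hδ
  have hδ0 : 0 < δ := div_pos (by linarith) (by linarith)
  have hs : θ * (N / 2 + δ) = θ * N / 4 + 1 / 4 := by
    rw [hδ]; field_simp; ring
  have hlog : 0 < -Real.log κ := by linarith [Real.log_neg hκ0 hκ1]
  set c := Real.cos (Real.pi * θ) / 4 with hc
  have hc0 : 0 < c := div_pos (cos_pi_mul_pos h0 h1) (by norm_num)
  refine ⟨θ * (N / 2 + δ), c ^ (-(N : ℝ) / 2) * 4 ^ δ * (K₁ + 1), min δ (-Real.log κ),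
    by positivity, by linarith, by positivity, lt_min hδ0 hlog, e, he, ?_⟩
  intro a M hzero z hz
  have hu := norm_one_sub_sq_pos hz
  have hlens := cos_div_mul_le_one_sub_norm_lens_sq h0 h1 hz
  rw [← hc] at hlens
  have ht4 : ‖1 - z ^ 2‖ ^ θ ≤ 4 := by
    rw [← norm_cpow_mul_norm_cpow]
    calc _ ≤ (2 : ℝ) * 2 := by
          gcongr
          · exact norm_rpow_le_two h0 h1 (norm_one_add_le_two hz)
          · exact norm_rpow_le_two h0 h1 (norm_one_sub_le_two hz)
      _ = 4 := by norm_num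
  have hsplit : ‖1 - z ^ 2‖ ^ (-(θ * (N / 2 + δ))) = (‖1 - z ^ 2‖ ^ θ) ^ (-(N : ℝ) / 2 - δ) := by
    rw [← Real.rpow_mul hu.le]
    ring_nf
  rw [hsplit]
  have ht0 : 0 < ‖1 - z ^ 2‖ ^ θ := by positivity
  have hcover := exists_lens_eq_realMoebius_or_le h0 h1 hz M
  generalize ‖1 - z ^ 2‖ ^ θ = t at *
  have hw : (1 - ‖lens θ z‖ ^ 2) ^ (-(N : ℝ) / 2) ≤
      c ^ (-(N : ℝ) / 2) * (t ^ (-(N : ℝ) / 2 - δ) * t ^ δ) := by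
    rw [← Real.rpow_add ht0, sub_add_cancel, ← Real.mul_rpow hc0.le ht0.le]
    exact Real.rpow_le_rpow_of_nonpos (by positivity) hlens
      (by linarith [(Nat.cast_nonneg N : (0 : ℝ) ≤ N)])
  rcases hcover with ⟨j, hj, ζ, hζ, hlz⟩ | htM
  · have h := hloc a (lensCenter j) M (abs_lensCenter_lt_one j) (hzero j hj) ζ hζ
    rw [← hlz] at h
    have hκM : κ ^ M ≤ Real.exp (-min δ (-Real.log κ) * M) := by
      rw [← Real.rpow_natCast, Real.rpow_def_of_pos hκ0]
      refine Real.exp_le_exp.2 (mul_le_mul_of_nonneg_right ?_ (Nat.cast_nonneg M))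
      linarith [min_le_right δ (-Real.log κ)]
    calc ‖diagEval a (lens θ z)‖
        ≤ K₁ * κ ^ M * ((1 - ‖lens θ z‖ ^ 2) ^ (-(N : ℝ) / 2) * ‖a‖) := h
      _ ≤ (K₁ + 1) * Real.exp (-min δ (-Real.log κ) * M) *
          (c ^ (-(N : ℝ) / 2) * (t ^ (-(N : ℝ) / 2 - δ) * 4 ^ δ) * ‖a‖) := by
        refine mul_le_mul (mul_le_mul (by linarith) hκM (by positivity) (by positivity))
          (mul_le_mul_of_nonneg_right (hw.trans (by gcongr)) (norm_nonneg a)) ?_ (by positivity)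
        have : 0 ≤ 1 - ‖lens θ z‖ ^ 2 := le_trans (by positivity) hlens
        positivity
      _ = _ := by ring
  · have htδ : t ^ δ ≤ 4 ^ δ * Real.exp (-min δ (-Real.log κ) * M) := by
      calc t ^ δ ≤ (4 * Real.exp (-M)) ^ δ := by gcongr
        _ = 4 ^ δ * Real.exp (-δ * M) := by
          rw [Real.mul_rpow (by norm_num) (Real.exp_pos _).le, ← Real.exp_mul]
          ring_nf
        _ ≤ _ := by
          gcongr
          exact min_le_left _ _
    calc ‖diagEval a (lens θ z)‖
        ≤ (1 - ‖lens θ z‖ ^ 2) ^ (-(N : ℝ) / 2) * ‖a‖ :=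
          norm_diagEval_le (norm_lens_lt_one h0 h1 hz) a
      _ ≤ 1 * (c ^ (-(N : ℝ) / 2) * (t ^ (-(N : ℝ) / 2 - δ) *
          (4 ^ δ * Real.exp (-min δ (-Real.log κ) * M))) * ‖a‖) := by
        rw [one_mul]
        refine mul_le_mul_of_nonneg_right (hw.trans (by gcongr)) (norm_nonneg a)
      _ ≤ (K₁ + 1) * (c ^ (-(N : ℝ) / 2) * (t ^ (-(N : ℝ) / 2 - δ) *
          (4 ^ δ * Real.exp (-min δ (-Real.log κ) * M))) * ‖a‖) := by
        gcongr
        linarith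
      _ = _ := by ring

/-! ### The composition operator -/

lemma taylorCoeff_congr {f g : ℂ → ℂ} (h : ∀ z, ‖z‖ < 1 → f z = g z) (k : ℕ) :
    taylorCoeff f k = taylorCoeff g k := by
  have : f =ᶠ[𝓝 0] g := by
    filter_upwards [Metric.ball_mem_nhds (0 : ℂ) one_pos] with z hz
    exact h z (mem_ball_zero_iff.1 hz)
  rw [taylorCoeff, taylorCoeff, this.iteratedDeriv_eq]

lemma taylorCoeff_add {f g : ℂ → ℂ} (hf : DifferentiableOn ℂ f (Metric.ball 0 1))
    (hg : DifferentiableOn ℂ g (Metric.ball 0 1)) (k : ℕ) :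
    taylorCoeff (fun z => f z + g z) k = taylorCoeff f k + taylorCoeff g k := by
  have hmem := Metric.ball_mem_nhds (0 : ℂ) one_pos
  rw [taylorCoeff, taylorCoeff, taylorCoeff, ← mul_add,
    ← iteratedDeriv_add (hf.analyticAt hmem).contDiffAt (hg.analyticAt hmem).contDiffAt]
  rfl

lemma taylorCoeff_const_mul {f : ℂ → ℂ} (hf : DifferentiableOn ℂ f (Metric.ball 0 1)) (c : ℂ)
    (k : ℕ) : taylorCoeff (fun z => c * f z) k = c * taylorCoeff f k := by
  have hmem := Metric.ball_mem_nhds (0 : ℂ) one_pos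
  rw [taylorCoeff, taylorCoeff, iteratedDeriv_const_mul c (hf.analyticAt hmem).contDiffAt]
  ring

/-- The coefficients on `ℕ^N` of a function of the variable `z i₀` only. -/
def liftCoeff {N : ℕ} (i₀ : Fin N) (c : ℕ → ℂ) (α : Fin N → ℕ) : ℂ :=
  if α = Pi.single i₀ (α i₀) then c (α i₀) else 0

lemma sum_norm_liftCoeff_sq_le {N : ℕ} (i₀ : Fin N) {c : ℕ → ℂ} {B : ℝ}
    (hc : ∀ S : Finset ℕ, ∑ k ∈ S, ‖c k‖ ^ 2 ≤ B) (S : Finset (Fin N → ℕ)) :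
    ∑ α ∈ S, ‖liftCoeff i₀ c α‖ ^ 2 ≤ B := by
  classical
  refine le_trans (le_of_eq ?_)
    (hc ((S.filter fun α => α = Pi.single i₀ (α i₀)).image fun α => α i₀))
  rw [Finset.sum_image, Finset.sum_filter]
  · refine Finset.sum_congr rfl fun α _ => ?_
    rw [liftCoeff]
    split_ifs <;> simp
  · intro α hα β hβ hαβ
    have h1 := (Finset.mem_filter.1 hα).2
    have h2 := (Finset.mem_filter.1 hβ).2
    simp only at hαβ
    rw [h1, h2, hαβ]

lemma tsum_liftCoeff {N : ℕ} (i₀ : Fin N) (c : ℕ → ℂ) (z : Fin N → ℂ) :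
    ∑' α : Fin N → ℕ, liftCoeff i₀ c α * ∏ i, z i ^ α i = ∑' k, c k * z i₀ ^ k := by
  have hinj : Function.Injective fun k : ℕ => (Pi.single i₀ k : Fin N → ℕ) :=
    fun k l h => by simpa using congrFun h i₀
  rw [← hinj.tsum_eq]
  · refine tsum_congr fun k => ?_
    have h1 : liftCoeff i₀ c (Pi.single i₀ k) = c k := by simp [liftCoeff]
    rw [h1, Fintype.prod_eq_single i₀ fun i hi => by simp [hi], Pi.single_eq_same]
  · intro α hα
    by_contra hne
    refine hα ?_
    have : liftCoeff i₀ c α = 0 := if_neg fun h => hne ⟨_, h.symm⟩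
    simp [this]

/-- An operator approximated at rate `e^(-d M)` by operators of rank at most `(2 M + 1) M` has
approximation numbers of order `e^(-c √n)`. -/
lemma exists_approxNum_le {E F : Type*} [NormedAddCommGroup E] [NormedAddCommGroup F]
    [NormedSpace ℂ E] [NormedSpace ℂ F] (T : E →L[ℂ] F) {C d : ℝ} (hC : 0 < C) (hd : 0 < d)
    (h : ∀ M : ℕ, ∃ R : E →L[ℂ] F,
      Module.rank ℂ (LinearMap.range (R : E →ₗ[ℂ] F)) ≤ ((2 * M + 1) * M : ℕ) ∧
      ‖T - R‖ ≤ C * Real.exp (-d * M)) :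
    ∃ C > (0 : ℝ), ∃ d > (0 : ℝ), ∀ n : ℕ, 1 ≤ n →
      approxNum n T ≤ C * Real.exp (-d * Real.sqrt n) := by
  refine ⟨C * Real.exp d, by positivity, d / 2, by positivity, fun n hn => ?_⟩
  set M := ⌊Real.sqrt n / 2⌋₊ with hM
  have hn' : (1 : ℝ) ≤ n := by exact_mod_cast hn
  have hM1 : (M : ℝ) ≤ Real.sqrt n / 2 := Nat.floor_le (by positivity)
  have hM2 : Real.sqrt n / 2 < M + 1 := Nat.lt_floor_add_one _
  have hsq := Real.sq_sqrt (Nat.cast_nonneg n : (0 : ℝ) ≤ n)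
  have hlt : (2 * M + 1) * M < n := by
    have h1 : M ≤ M * M := Nat.le_mul_self M
    have h2 : (M : ℝ) ≤ M * M := by exact_mod_cast h1
    have h3 : ((2 * M + 1) * M : ℝ) < n := by
      nlinarith [(Nat.cast_nonneg M : (0 : ℝ) ≤ M)]
    exact_mod_cast h3
  obtain ⟨R, hR, hTR⟩ := h M
  calc approxNum n T ≤ ‖T - R‖ := by
        refine csInf_le ⟨0, ?_⟩ ⟨R, hR.trans_lt (by exact_mod_cast hlt), rfl⟩
        rintro _ ⟨R', _, rfl⟩
        exact norm_nonneg _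
    _ ≤ C * Real.exp (-d * M) := hTR
    _ ≤ C * Real.exp (d + -(d / 2) * Real.sqrt n) := by
        gcongr
        nlinarith
    _ = _ := by rw [Real.exp_add, mul_assoc]

/-- An operator that is small on the vectors orthogonal to a finite set is close to an operator
of small finite rank. -/
lemma exists_finiteRank_approx.{u} {E F : Type u} [NormedAddCommGroup E] [InnerProductSpace ℂ E]
    [NormedAddCommGroup F] [NormedSpace ℂ F] (T : E →L[ℂ] F) (S : Finset E) {ε : ℝ}
    (hε : 0 ≤ ε) (h : ∀ x, (∀ v ∈ S, inner ℂ v x = 0) → ‖T x‖ ≤ ε * ‖x‖) :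
    ∃ R : E →L[ℂ] F, Module.rank ℂ (LinearMap.range (R : E →ₗ[ℂ] F)) ≤ (S.card : Cardinal) ∧
      IsCompactOperator ⇑R ∧ ‖T - R‖ ≤ ε := by
  set W : Submodule ℂ E := Submodule.span ℂ (S : Set E) with hW
  have hfd : FiniteDimensional ℂ W := FiniteDimensional.span_finset ℂ S
  have hproper : ProperSpace W := FiniteDimensional.proper ℂ W
  refine ⟨(T ∘L W.subtypeL) ∘L W.orthogonalProjectionOnto, ?_, ?_, ?_⟩
  · have hle : LinearMap.range (((T ∘L W.subtypeL) ∘L W.orthogonalProjectionOnto : E →L[ℂ] F) :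
        E →ₗ[ℂ] F) ≤ LinearMap.range ((T ∘L W.subtypeL : W →L[ℂ] F) : W →ₗ[ℂ] F) := by
      rintro _ ⟨x, rfl⟩
      exact ⟨_, rfl⟩
    exact (Submodule.rank_mono hle).trans ((rank_range_le _).trans (rank_span_finset_le S))
  · exact (isCompactOperator_of_locallyCompactSpace_rng
      (T ∘L W.subtypeL)).comp_clm _
  · refine ContinuousLinearMap.opNorm_le_bound _ hε fun x => ?_
    have hx : ((T - (T ∘L W.subtypeL) ∘L W.orthogonalProjectionOnto : E →L[ℂ] F)) x =
        T (x - W.starProjection x) := by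
      simp [map_sub]
    rw [hx]
    have hmem : x - W.starProjection x ∈ Wᗮ := Submodule.sub_starProjection_mem_orthogonal x
    refine (h _ fun v hv => ?_).trans (mul_le_mul_of_nonneg_left ?_ hε)
    · exact (Submodule.mem_orthogonal W _).1 hmem v (Submodule.subset_span hv)
    · rw [← Submodule.starProjection_orthogonal_val]
      exact Submodule.norm_starProjection_apply_le _ _

/-- The composition operator with symbol `(φ (z i₀), …, φ (z i₀))`, described on coefficients. -/
lemma exists_isCompOpPoly_diagonal {N : ℕ} (i₀ : Fin N) {φ : ℂ → ℂ}
    (hφ : ∀ z, ‖z‖ < 1 → ‖φ z‖ < 1) (hd : DifferentiableOn ℂ φ (Metric.ball 0 1)) {B : ℝ}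
    (hB : 0 ≤ B) (hbound : ∀ (a : H2poly N) (S : Finset ℕ),
      ∑ k ∈ S, ‖taylorCoeff (fun z => diagEval a (φ z)) k‖ ^ 2 ≤ (B * ‖a‖) ^ 2) :
    ∃ T : H2poly N →L[ℂ] H2poly N, IsCompOpPoly (fun z _ => φ (z i₀)) T ∧
      ∀ a α, T a α = liftCoeff i₀ (taylorCoeff fun z => diagEval a (φ z)) α := by
  have hda (a : H2poly N) : DifferentiableOn ℂ (fun z => diagEval a (φ z)) (Metric.ball 0 1) :=
    (differentiableOn_diagEval a).comp hd fun z hz =>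
      mem_ball_zero_iff.2 (hφ z (mem_ball_zero_iff.1 hz))
  have hmem (a : H2poly N) :
      Memℓp (liftCoeff i₀ (taylorCoeff fun z => diagEval a (φ z))) 2 := by
    refine memℓp_gen' (C := (B * ‖a‖) ^ 2) fun S => ?_
    simpa using sum_norm_liftCoeff_sq_le i₀ (hbound a) S
  let T₀ : H2poly N →ₗ[ℂ] H2poly N :=
    { toFun := fun a => ⟨liftCoeff i₀ (taylorCoeff fun z => diagEval a (φ z)), hmem a⟩
      map_add' := fun a b => by
        ext α
        change liftCoeff _ _ α = liftCoeff _ _ α + liftCoeff _ _ α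
        simp only [liftCoeff]
        split_ifs
        · rw [← taylorCoeff_add (hda a) (hda b)]
          exact taylorCoeff_congr (fun z hz => diagEval_add (hφ z hz) a b) _
        · simp
      map_smul' := fun c a => by
        ext α
        change liftCoeff _ _ α = c * liftCoeff _ _ α
        simp only [liftCoeff]
        split_ifs
        · rw [← taylorCoeff_const_mul (hda a)]
          exact taylorCoeff_congr (fun z hz => diagEval_smul (hφ z hz) c a) _
        · simp }
  have hT₀ (a : H2poly N) : ‖T₀ a‖ ≤ B * ‖a‖ := by
    refine lp.norm_le_of_forall_sum_le (p := 2) (by norm_num) (by positivity) fun S => ?_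
    simp only [ENNReal.toReal_ofNat, Real.rpow_ofNat]
    exact sum_norm_liftCoeff_sq_le i₀ (hbound a) S
  refine ⟨T₀.mkContinuous B hT₀, fun a z hz => ?_, fun a α => rfl⟩
  exact (tsum_liftCoeff i₀ _ z).trans (hasSum_taylorCoeff (hda a) (hz i₀)).tsum_eq

/-- for `N ≥ 2` and `0 < θ < 1/N`, the composition operator by
`Φ(z₁,…,z_N) = (λ_θ(z₁),…,λ_θ(z₁))` is compact on `H²(𝔻^N)`, with
`a_n(C_Φ) ≤ C e^{-d √n}`. -/
theorem stmt_9 (N : ℕ) (hN : 2 ≤ N) (θ : ℝ) (hθ0 : 0 < θ) (hθN : θ < 1 / (N : ℝ)) :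
    ∃ T : H2poly N →L[ℂ] H2poly N,
      IsCompOpPoly (fun z _ => lens θ (z ⟨0, by omega⟩)) T ∧
      IsCompactOperator ⇑T ∧
      ∃ C > (0 : ℝ), ∃ d > (0 : ℝ), ∀ n : ℕ, 1 ≤ n →
        approxNum n T ≤ C * Real.exp (-d * Real.sqrt n) := by
  classical
  have hN' : (2 : ℝ) ≤ N := by exact_mod_cast hN
  have hθN' : θ * N < 1 := (lt_div_iff₀ (by linarith)).1 hθN
  have hθ : θ < 1 / 2 := by nlinarith
  obtain ⟨s, K, d, hs0, hs, hK, hd, e, he, hgrowth⟩ :=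
    exists_norm_diagEval_lens_le (N := N) hθ0 hθ hθN'
  obtain ⟨C, hC, hcoeff⟩ := exists_sum_taylorCoeff_sq_le hs0 hs
  have hlens := fun z (hz : ‖z‖ < 1) => norm_lens_lt_one hθ0 hθ hz
  have hda (a : H2poly N) :
      DifferentiableOn ℂ (fun z => diagEval a (lens θ z)) (Metric.ball 0 1) :=
    (differentiableOn_diagEval a).comp (differentiableOn_lens hθ0 hθ) fun z hz =>
      mem_ball_zero_iff.2 (hlens z (mem_ball_zero_iff.1 hz))
  have hbound (a : H2poly N) (M : ℕ) (hzero : ∀ j ∈ Finset.Icc (-(M : ℤ)) M, ∀ i < M,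
      diagEval a (realMoebius (lensCenter j) (e i)) = 0) (S : Finset ℕ) :
      ∑ k ∈ S, ‖taylorCoeff (fun z => diagEval a (lens θ z)) k‖ ^ 2 ≤
        (C * K * Real.exp (-d * M) * ‖a‖) ^ 2 := by
    have h := hcoeff _ _ (by positivity) (hda a) (hgrowth a M hzero) S
    simpa only [mul_assoc] using h
  obtain ⟨T, hT, hTcoeff⟩ := exists_isCompOpPoly_diagonal (⟨0, by omega⟩ : Fin N) hlens
    (differentiableOn_lens hθ0 hθ) (B := C * K) (by positivity) fun a S => by
      simpa using hbound a 0 (by simp) S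
  have hkernel (j : ℤ) (i : ℕ) : ∃ v : H2poly N, ∀ a : H2poly N,
      diagEval a (realMoebius (lensCenter j) (e i)) = inner ℂ v a :=
    ⟨_, diagEval_eq_inner (norm_realMoebius_lt_one (abs_lensCenter_lt_one j) (he i))⟩
  choose k hk using hkernel
  have happrox (M : ℕ) : ∃ R : H2poly N →L[ℂ] H2poly N,
      Module.rank ℂ (LinearMap.range (R : H2poly N →ₗ[ℂ] H2poly N)) ≤ ((2 * M + 1) * M : ℕ) ∧
      IsCompactOperator ⇑R ∧ ‖T - R‖ ≤ C * K * Real.exp (-d * M) := by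
    let S : Finset (H2poly N) := (Finset.Icc (-(M : ℤ)) M ×ˢ Finset.range M).image
      fun x => k x.1 x.2
    have hcard : S.card ≤ (2 * M + 1) * M := by
      refine Finset.card_image_le.trans (le_of_eq ?_)
      rw [Finset.card_product, Int.card_Icc, Finset.card_range]
      congr 1
      omega
    have hsmall (a : H2poly N) (ha : ∀ v ∈ S, inner ℂ v a = 0) :
        ‖T a‖ ≤ C * K * Real.exp (-d * M) * ‖a‖ := by
      have hz (j : ℤ) (hj : j ∈ Finset.Icc (-(M : ℤ)) M) (i : ℕ) (hi : i < M) :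
          diagEval a (realMoebius (lensCenter j) (e i)) = 0 := by
        rw [hk]
        exact ha _ (Finset.mem_image.2
          ⟨(j, i), Finset.mk_mem_product hj (Finset.mem_range.2 hi), rfl⟩)
      refine lp.norm_le_of_forall_sum_le (p := 2) (by norm_num) (by positivity) fun F => ?_
      simp only [ENNReal.toReal_ofNat, Real.rpow_ofNat, hTcoeff]
      exact sum_norm_liftCoeff_sq_le _ (hbound a M hz) F
    obtain ⟨R, hR, hRc, hTR⟩ := exists_finiteRank_approx T S (by positivity) hsmall
    exact ⟨R, hR.trans (by exact_mod_cast hcard), hRc, hTR⟩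
  refine ⟨T, hT, ?_, exists_approxNum_le T (mul_pos hC hK) hd fun M => ?_⟩
  · choose R _ hRc hTR using happrox
    refine isCompactOperator_of_tendsto (F := R) (l := atTop) ?_ (Eventually.of_forall hRc)
    rw [tendsto_iff_norm_sub_tendsto_zero]
    have hexp : Tendsto (fun M : ℕ => C * K * Real.exp (-d * M)) atTop (𝓝 0) := by
      have h := Real.tendsto_exp_atBot.comp
        (tendsto_natCast_atTop_atTop.const_mul_atTop_of_neg (neg_lt_zero.2 hd))
      simpa using h.const_mul (C * K)
    exact squeeze_zero (fun _ => norm_nonneg _)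
      (fun M => (norm_sub_rev _ _).trans_le (hTR M)) hexp
  · obtain ⟨R, hR, -, hTR⟩ := happrox M
    exact ⟨R, hR, hTR⟩

end
end

section
/- Let 0 < a < 1 and let B(z) = ((z − a)/(1 − a z))². Then B maps D into D, B(D ∖ {0}) = D (B restricted to the punctured disk is surjective onto D), and for every z ∈ D one has (1 − |B(z)|)/(1 − |z|) ≥ (1 − a²)/4. -/
open Complex MeasureTheory Set Filter
open scoped ENNReal Topology

noncomputable section

theorem norm_sq_one_sub_mul_sub_norm_sq_sub (a : ℝ) (z : ℂ) :
    ‖1 - (a : ℂ) * z‖ ^ 2 - ‖z - (a : ℂ)‖ ^ 2 = (1 - a ^ 2) * (1 - ‖z‖ ^ 2) := by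
  simp only [← Complex.normSq_eq_norm_sq, Complex.normSq_apply, Complex.sub_re, Complex.sub_im,
    Complex.mul_re, Complex.mul_im, Complex.ofReal_re, Complex.ofReal_im, Complex.one_re,
    Complex.one_im]
  ring

theorem norm_one_sub_mul_pos {a : ℝ} {z : ℂ} (ha : |a| < 1) (hz : ‖z‖ < 1) :
    0 < ‖1 - (a : ℂ) * z‖ := by
  have h := norm_sq_one_sub_mul_sub_norm_sq_sub a z
  have h₁ : 0 < (1 - a ^ 2) * (1 - ‖z‖ ^ 2) :=
    mul_pos (by nlinarith [sq_abs a, abs_nonneg a]) (by nlinarith [norm_nonneg z])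
  exact (sq_pos_iff.1 (by nlinarith [sq_nonneg ‖z - (a : ℂ)‖])).lt_of_le' (norm_nonneg _)

/-- The Schwarz-Pick identity for the automorphism `z ↦ (z - a) / (1 - a z)`. -/
theorem one_sub_norm_sq_mobius {a : ℝ} {z : ℂ} (ha : |a| < 1) (hz : ‖z‖ < 1) :
    1 - ‖((z - (a : ℂ)) / (1 - (a : ℂ) * z)) ^ 2‖ =
      (1 - a ^ 2) * (1 - ‖z‖ ^ 2) / ‖1 - (a : ℂ) * z‖ ^ 2 := by
  have h := norm_one_sub_mul_pos ha hz
  rw [← norm_sq_one_sub_mul_sub_norm_sq_sub, norm_pow, norm_div, div_pow, sub_div, div_self]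
  positivity

theorem norm_mobius_sq_lt_one {a : ℝ} {z : ℂ} (ha : |a| < 1) (hz : ‖z‖ < 1) :
    ‖((z - (a : ℂ)) / (1 - (a : ℂ) * z)) ^ 2‖ < 1 := by
  have h := norm_one_sub_mul_pos ha hz
  have h₁ : 0 < (1 - a ^ 2) * (1 - ‖z‖ ^ 2) :=
    mul_pos (by nlinarith [sq_abs a, abs_nonneg a]) (by nlinarith [norm_nonneg z])
  rw [← sub_pos, one_sub_norm_sq_mobius ha hz]
  positivity

theorem norm_mobius_lt_one {a : ℝ} {z : ℂ} (ha : |a| < 1) (hz : ‖z‖ < 1) :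
    ‖(z - (a : ℂ)) / (1 - (a : ℂ) * z)‖ < 1 := by
  have h := norm_mobius_sq_lt_one ha hz
  rwa [norm_pow, sq_lt_one_iff₀ (norm_nonneg _)] at h

/-- `z ↦ (z + a) / (1 + a z)` is a right inverse of `z ↦ (z - a) / (1 - a z)` on the disk. -/
theorem mobius_mobius_neg {a : ℝ} {v : ℂ} (ha : |a| < 1) (hv : ‖v‖ < 1) :
    ((v + a) / (1 + a * v) - (a : ℂ)) / (1 - (a : ℂ) * ((v + a) / (1 + a * v))) = v := by
  have h : (1 + (a : ℂ) * v) ≠ 0 := by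
    have := norm_pos_iff.1 (norm_one_sub_mul_pos (a := -a) (by rwa [abs_neg]) hv)
    simpa using this
  have h₁ : (1 - (a : ℂ) ^ 2) ≠ 0 := by
    have : 1 - a ^ 2 ≠ 0 := by nlinarith [sq_abs a, abs_nonneg a]
    exact_mod_cast this
  have hnum : (v + a) / (1 + a * v) - (a : ℂ) = (1 - (a : ℂ) ^ 2) * v / (1 + a * v) := by
    rw [eq_div_iff h, sub_mul, div_mul_cancel₀ _ h]
    ring
  have hden : 1 - (a : ℂ) * ((v + a) / (1 + a * v)) = (1 - (a : ℂ) ^ 2) / (1 + a * v) := by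
    field_simp
    ring
  rw [hnum, hden]
  field_simp

theorem exists_sq_eq_and_add_ne_zero {a : ℂ} (ha : a ≠ 0) (w : ℂ) :
    ∃ v : ℂ, v ^ 2 = w ∧ v + a ≠ 0 := by
  obtain ⟨v, rfl⟩ := IsAlgClosed.exists_pow_nat_eq w two_pos
  by_cases h : v + a = 0
  · refine ⟨-v, neg_sq v, ?_⟩
    rw [eq_neg_of_add_eq_zero_left h, neg_neg, ← two_mul]
    exact mul_ne_zero two_ne_zero ha
  · exact ⟨v, rfl, h⟩

/-- for `0 < a < 1` and `B(z) = ((z-a)/(1-az))²`, `B` maps `𝔻` into `𝔻`,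
`B(𝔻 \ {0}) = 𝔻`, and `(1-|B(z)|)/(1-|z|) ≥ (1-a²)/4` on `𝔻`. -/
theorem stmt_11 (a : ℝ) (ha0 : 0 < a) (ha1 : a < 1) :
    Set.MapsTo (fun z : ℂ => ((z - (a : ℂ)) / (1 - (a : ℂ) * z)) ^ 2) unitDisk unitDisk ∧
    (fun z : ℂ => ((z - (a : ℂ)) / (1 - (a : ℂ) * z)) ^ 2) '' (unitDisk \ {0}) = unitDisk ∧
    ∀ z ∈ unitDisk,
      (1 - a ^ 2) / 4 ≤
        (1 - ‖((z - (a : ℂ)) / (1 - (a : ℂ) * z)) ^ 2‖) / (1 - ‖z‖) := by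
  have ha : |a| < 1 := by rwa [abs_of_pos ha0]
  have hmaps : Set.MapsTo (fun z : ℂ => ((z - (a : ℂ)) / (1 - (a : ℂ) * z)) ^ 2)
      unitDisk unitDisk := by
    intro z hz
    exact mem_ball_zero_iff.2 (norm_mobius_sq_lt_one ha (mem_ball_zero_iff.1 hz))
  refine ⟨hmaps, (hmaps.mono_left Set.sdiff_subset).image_subset.antisymm ?_, ?_⟩
  · intro w hw
    obtain ⟨v, rfl, hva⟩ :=
      exists_sq_eq_and_add_ne_zero (Complex.ofReal_ne_zero.2 ha0.ne') w
    have hv : ‖v‖ < 1 := by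
      have := mem_ball_zero_iff.1 hw
      rwa [norm_pow, sq_lt_one_iff₀ (norm_nonneg _)] at this
    have ha' : |-a| < 1 := by rwa [abs_neg]
    have hz := norm_mobius_lt_one ha' hv
    have hne := norm_pos_iff.1 (norm_one_sub_mul_pos ha' hv)
    simp only [Complex.ofReal_neg, sub_neg_eq_add, neg_mul] at hz hne
    exact ⟨(v + a) / (1 + a * v), ⟨mem_ball_zero_iff.2 hz, div_ne_zero hva hne⟩,
      congrArg (· ^ 2) (mobius_mobius_neg ha hv)⟩
  · intro z hz
    replace hz : ‖z‖ < 1 := mem_ball_zero_iff.1 hz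
    have hpos := norm_one_sub_mul_pos ha hz
    have hle : ‖1 - (a : ℂ) * z‖ ≤ 2 := by
      calc ‖1 - (a : ℂ) * z‖ ≤ ‖(1 : ℂ)‖ + ‖(a : ℂ) * z‖ := norm_sub_le _ _
        _ = 1 + |a| * ‖z‖ := by simp
        _ ≤ 2 := by nlinarith [norm_nonneg z, abs_nonneg a]
    have hsq : ‖1 - (a : ℂ) * z‖ ^ 2 ≤ 4 := by nlinarith
    have ha2 : 0 < 1 - a ^ 2 := by nlinarith
    rw [one_sub_norm_sq_mobius ha hz, le_div_iff₀ (sub_pos.2 hz), div_mul_eq_mul_div]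
    have hz' : 0 ≤ 1 - ‖z‖ := (sub_pos.2 hz).le
    have hzz : 1 - ‖z‖ ≤ 1 - ‖z‖ ^ 2 := by nlinarith [norm_nonneg z]
    gcongr
    exact mul_nonneg ha2.le (hz'.trans hzz)

end
end
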